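/- arXiv:2605.13425 — 4 statements merged into one kernel-verified Lean document; each statement's English description precedes it below -/
import Mathlib

section
/- Let k be a field of characteristic ≠ 2, let n be an odd positive integer that is invertible in k (i.e. (n : k) ≠ 0), and let s ∈ k be such that the polynomial Xⁿ − s is irreducible in k[X]. Set L = k[X]/(Xⁿ − s). Then the trace form of L over k is isometric to ⟨n⟩ ⊥ ((n−1)/2 copies of (⟨1⟩ ⊥ ⟨−1⟩)). -/
open Polynomial

/-- The trace form of a (finite) `k`-algebra `L` as a quadratic form: `x ↦ Tr_{L/k}(x²)`. -/
noncomputable def traceQuadraticForm (k L : Type*) [CommRing k] [CommRing L] [Algebra k L] :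
    QuadraticMap k L k :=
  LinearMap.BilinMap.toQuadraticMap (Algebra.traceForm k L)

/-- The diagonal weights `⟨n⟩ ⊥ ((n-1)/2 copies of (⟨1⟩ ⊥ ⟨-1⟩))`:
index `0` carries `n`, and the remaining `n - 1` indices alternate `1, -1`. -/
noncomputable def oddCyclicTraceWeights (k : Type*) [Field k] (n : ℕ) : Fin n → k :=
  fun i => if (i : ℕ) = 0 then (n : k) else if (i : ℕ) % 2 = 1 then 1 else -1

/-- `Tr(x^m) = 0` for `0 < m < n`, when `1, x, …, x^(n-1)` is a basis and `x^n = s`. -/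
lemma oddCyclic_trace_pow {k L : Type*} [Field k] [CommRing L] [Algebra k L] {n : ℕ}
    (b : Module.Basis (Fin n) k L) (x : L) (s : k) (hb : ∀ i, b i = x ^ (i : ℕ))
    (hx : x ^ n = algebraMap k L s) (m : ℕ) (h0 : 0 < m) (hm : m < n) :
    Algebra.trace k L (x ^ m) = 0 := by
  rw [Algebra.trace_eq_matrix_trace b, Matrix.trace]
  refine Finset.sum_eq_zero fun j _ => ?_
  rw [Matrix.diag_apply, Algebra.leftMulMatrix_eq_repr_mul, hb, ← pow_add]
  by_cases h : m + j < n
  · rw [show x ^ (m + (j : ℕ)) = b ⟨m + j, h⟩ from (hb ⟨m + j, h⟩).symm, Module.Basis.repr_self,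
      Finsupp.single_eq_of_ne]
    intro h'
    have := congrArg Fin.val h'
    simp at this
    omega
  · have hj := j.2
    have h2 : m + j - n < n := by omega
    have : x ^ (m + (j : ℕ)) = s • b ⟨m + j - n, h2⟩ := by
      rw [hb, Algebra.smul_def, ← hx, ← pow_add]
      congr 1
      simp only
      omega
    rw [this, map_smul, Module.Basis.repr_self, Finsupp.smul_apply, Finsupp.single_eq_of_ne,
      smul_zero]
    intro h'
    have := congrArg Fin.val h'
    simp at this
    omega

lemma oddCyclic_trace_pow' {k L : Type*} [Field k] [CommRing L] [Algebra k L] {n : ℕ}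
    (b : Module.Basis (Fin n) k L) (x : L) (s : k) (hb : ∀ i, b i = x ^ (i : ℕ))
    (hx : x ^ n = algebraMap k L s) (m : ℕ) (hm : m < 2 * n) :
    Algebra.trace k L (x ^ m) = if m = 0 then (n : k) else if m = n then n * s else 0 := by
  split_ifs with h1 h2
  · subst h1
    have := Algebra.trace_algebraMap_of_basis b (1 : k)
    simpa using this
  · subst h2
    rw [hx, Algebra.trace_algebraMap_of_basis b]
    simp
  · by_cases h : m < n
    · exact oddCyclic_trace_pow b x s hb hx m (by omega) h
    · have : x ^ m = s • x ^ (m - n) := by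
        rw [Algebra.smul_def, ← hx, ← pow_add]
        congr 1
        omega
      rw [this, map_smul, oddCyclic_trace_pow b x s hb hx (m - n) (by omega) (by omega), smul_zero]

/-- The orthogonal basis. -/
noncomputable def oddCyclicVec {k L : Type*} [Field k] [CommRing L] [Algebra k L] (n : ℕ)
    (x : L) (s : k) (i : Fin n) : L :=
  if (i : ℕ) = 0 then 1 else
    x ^ (((i : ℕ) + 1) / 2) + ((if (i : ℕ) % 2 = 1 then 1 else -1) * (2 * n * s)⁻¹ : k) •
      x ^ (n - ((i : ℕ) + 1) / 2)

lemma oddCyclic_traceForm {k L : Type*} [Field k] [CommRing L] [Algebra k L] {n : ℕ}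
    (h2 : (2 : k) ≠ 0) (hn : Odd n) (hn0 : (n : k) ≠ 0)
    (b : Module.Basis (Fin n) k L) (x : L) (s : k) (hb : ∀ i, b i = x ^ (i : ℕ))
    (hx : x ^ n = algebraMap k L s) (hs : n ≠ 1 → s ≠ 0) (i j : Fin n) :
    Algebra.traceForm k L (oddCyclicVec n x s i) (oddCyclicVec n x s j) =
      if i = j then oddCyclicTraceWeights k n i else 0 := by
  have T := oddCyclic_trace_pow' b x s hb hx
  have Tz : ∀ m, 0 < m → m < 2 * n → m ≠ n → Algebra.trace k L (x ^ m) = 0 := by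
    intro m h1 h2 h3
    rw [T m h2, if_neg h1.ne', if_neg h3]
  have Tn : ∀ m, m = n → Algebra.trace k L (x ^ m) = n * s := by
    rintro m rfl
    have := i.2
    rw [T m (by omega), if_neg (by omega), if_pos rfl]
  have hT0 : Algebra.trace k L 1 = n := by simpa using T 0 (by have := i.2; omega)
  obtain ⟨m, rfl⟩ := hn
  have hi := i.2
  have hj := j.2
  rw [Algebra.traceForm_apply]
  unfold oddCyclicVec oddCyclicTraceWeights
  by_cases hi0 : (i : ℕ) = 0
  · by_cases hj0 : (j : ℕ) = 0
    · have : i = j := Fin.ext (by omega)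
      rw [if_pos hi0, if_pos hj0, if_pos this, if_pos hi0, mul_one, hT0]
    · have : i ≠ j := fun h => hj0 (h ▸ hi0)
      rw [if_pos hi0, if_neg hj0, if_neg this, one_mul, map_add, map_smul,
        Tz _ (by omega) (by omega) (by omega), Tz _ (by omega) (by omega) (by omega)]
      simp
  · by_cases hj0 : (j : ℕ) = 0
    · have : i ≠ j := fun h => hi0 (h ▸ hj0)
      rw [if_neg hi0, if_pos hj0, if_neg this, mul_one, map_add, map_smul,
        Tz _ (by omega) (by omega) (by omega), Tz _ (by omega) (by omega) (by omega)]
      simp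
    · have hs' := hs (by omega)
      rw [if_neg hi0, if_neg hj0, if_neg hi0]
      simp only [add_mul, mul_add, smul_mul_assoc, mul_smul_comm, map_add, map_smul, ← pow_add]
      rw [Tz (((i : ℕ) + 1) / 2 + ((j : ℕ) + 1) / 2) (by omega) (by omega) (by omega),
        Tz (2 * m + 1 - ((i : ℕ) + 1) / 2 + (2 * m + 1 - ((j : ℕ) + 1) / 2))
          (by omega) (by omega) (by omega)]
      by_cases ht : ((i : ℕ) + 1) / 2 = ((j : ℕ) + 1) / 2
      · rw [Tn (2 * m + 1 - ((i : ℕ) + 1) / 2 + ((j : ℕ) + 1) / 2) (by omega),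
          Tn (((i : ℕ) + 1) / 2 + (2 * m + 1 - ((j : ℕ) + 1) / 2)) (by omega)]
        generalize ((2 * m + 1 : ℕ) : k) = N at *
        by_cases hij : i = j
        · subst hij
          rw [if_pos rfl]
          split_ifs <;> simp only [smul_eq_mul] <;> field_simp <;> ring
        · have : (i : ℕ) ≠ j := fun h => hij (Fin.ext h)
          rw [if_neg hij]
          by_cases h : (i : ℕ) % 2 = 1
          · have h' : ¬ (j : ℕ) % 2 = 1 := by omega
            simp [h, h']
          · have h' : (j : ℕ) % 2 = 1 := by omega
            simp [h, h']
      · rw [Tz (2 * m + 1 - ((i : ℕ) + 1) / 2 + ((j : ℕ) + 1) / 2)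
            (by omega) (by omega) (by omega),
          Tz (((i : ℕ) + 1) / 2 + (2 * m + 1 - ((j : ℕ) + 1) / 2))
            (by omega) (by omega) (by omega)]
        have hij : i ≠ j := fun h => ht (by rw [h])
        simp [hij]

/-- For `k` of characteristic `≠ 2`, `n` odd positive and invertible in `k`, and `Xⁿ - s`
irreducible, the trace form of `L = k[X]/(Xⁿ - s)` is isometric to
`⟨n⟩ ⊥ ((n-1)/2 copies of (⟨1⟩ ⊥ ⟨-1⟩))`. -/
theorem traceForm_adjoinRoot_pow_sub_of_odd
    (k : Type*) [Field k] (hchar : (2 : k) ≠ 0)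
    (n : ℕ) (hn : Odd n) (hpos : 0 < n) (hninv : (n : k) ≠ 0)
    (s : k) (hirr : Irreducible ((X : k[X]) ^ n - C s)) :
    QuadraticMap.Equivalent
      (traceQuadraticForm k (AdjoinRoot ((X : k[X]) ^ n - C s)))
      (QuadraticMap.weightedSumSquares k (oddCyclicTraceWeights k n)) := by
  have : Invertible (2 : k) := invertibleOfNonzero hchar
  have hmon : ((X : k[X]) ^ n - C s).Monic := monic_X_pow_sub_C s hpos.ne'
  have hdim : (AdjoinRoot.powerBasis' hmon).dim = n := by
    simp [AdjoinRoot.powerBasis', natDegree_X_pow_sub_C]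
  let b := (AdjoinRoot.powerBasis' hmon).basis.reindex (finCongr hdim)
  let x := AdjoinRoot.root ((X : k[X]) ^ n - C s)
  have hb : ∀ i, b i = x ^ (i : ℕ) := by
    intro i
    simp only [b, Module.Basis.reindex_apply, PowerBasis.coe_basis]
    rfl
  have hx : x ^ n = algebraMap k _ s := by
    have := AdjoinRoot.eval₂_root ((X : k[X]) ^ n - C s)
    rw [eval₂_sub, eval₂_X_pow, eval₂_C, sub_eq_zero] at this
    exact this
  have hs : n ≠ 1 → s ≠ 0 := by
    rintro h1 rfl
    rw [C_0, sub_zero] at hirr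
    exact not_irreducible_pow h1 hirr
  have key := oddCyclic_traceForm hchar hn hninv b x s hb hx hs
  have hli : LinearIndependent k (oddCyclicVec n x s) := by
    refine LinearMap.BilinForm.linearIndependent_of_iIsOrtho
      (B := Algebra.traceForm k (AdjoinRoot ((X : k[X]) ^ n - C s))) ?_ ?_
    · rw [LinearMap.BilinForm.iIsOrtho_def]
      intro i j hij
      rw [key, if_neg hij]
    · intro i
      rw [key, if_pos rfl]
      unfold oddCyclicTraceWeights
      split_ifs <;> simp [hninv]
  have : Nonempty (Fin n) := ⟨⟨0, hpos⟩⟩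
  let v := basisOfLinearIndependentOfCardEqFinrank hli (Module.finrank_eq_card_basis b).symm
  have hv : ∀ i, v i = oddCyclicVec n x s i := fun i => by simp [v]
  have hort : (QuadraticMap.associated (R := k) (traceQuadraticForm k
      (AdjoinRoot ((X : k[X]) ^ n - C s)))).IsOrthoᵢ v := by
    rw [traceQuadraticForm,
      QuadraticMap.associated_left_inverse k (Algebra.traceForm_isSymm k).eq]
    intro i j hij
    change Algebra.traceForm k _ (v i) (v j) = 0
    rw [hv, hv, key, if_neg hij]
  have e := (traceQuadraticForm k (AdjoinRoot ((X : k[X]) ^ n - C s))).isometryEquivBasisRepr v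
  rw [QuadraticMap.basisRepr_eq_of_iIsOrtho _ _ hort] at e
  have hw : (fun i => traceQuadraticForm k (AdjoinRoot ((X : k[X]) ^ n - C s)) (v i)) =
      oddCyclicTraceWeights k n := by
    funext i
    change Algebra.traceForm k _ (v i) (v i) = _
    rw [hv, key, if_pos rfl]
  rw [hw] at e
  exact ⟨e⟩
end

section
/- Let k be a field of characteristic ≠ 2, let n be an even positive integer that is invertible in k (i.e. (n : k) ≠ 0), and let s ∈ k be such that the polynomial Xⁿ − s is irreducible in k[X]. Set L = k[X]/(Xⁿ − s). Then the trace form of L over k is isometric to ⟨n⟩ ⊥ ⟨n·s⟩ ⊥ ((n−2)/2 copies of (⟨1⟩ ⊥ ⟨−1⟩)). -/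
open Polynomial

/-- The diagonal weights `⟨n⟩ ⊥ ⟨n·s⟩ ⊥ ((n-2)/2 copies of (⟨1⟩ ⊥ ⟨-1⟩))`:
index `0` carries `n`, index `1` carries `n·s`, and the remaining `n - 2` indices
alternate `1, -1`. -/
noncomputable def evenCyclicTraceWeights (k : Type*) [Field k] (n : ℕ) (s : k) : Fin n → k :=
  fun i =>
    if (i : ℕ) = 0 then (n : k)
    else if (i : ℕ) = 1 then (n : k) * s
    else if (i : ℕ) % 2 = 0 then 1 else -1

/-- The traces of small powers of the root of `X ^ n - s`. -/
lemma trace_root_pow_eq_zero (k : Type*) [Field k] (n : ℕ) (hpos : 0 < n) (s : k)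
    (t : ℕ) (ht : 0 < t) (htn : t < n) :
    Algebra.trace k (AdjoinRoot ((X : k[X]) ^ n - C s))
      (AdjoinRoot.root ((X : k[X]) ^ n - C s) ^ t) = 0 := by
  have hmon : ((X : k[X]) ^ n - C s).Monic := monic_X_pow_sub_C s hpos.ne'
  have hdeg : ((X : k[X]) ^ n - C s).natDegree = n := natDegree_X_pow_sub_C
  set f := (X : k[X]) ^ n - C s with hf
  have hroot : AdjoinRoot.root f ^ n = algebraMap k _ s := by
    have h := AdjoinRoot.eval₂_root f
    rw [hf] at h
    simp only [eval₂_sub, eval₂_X_pow, eval₂_C] at h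
    exact sub_eq_zero.mp h
  let pb := AdjoinRoot.powerBasis' hmon
  have hgen : pb.gen = AdjoinRoot.root f := AdjoinRoot.powerBasis'_gen hmon
  have hdim : pb.dim = n := by rw [AdjoinRoot.powerBasis'_dim, hdeg]
  rw [Algebra.trace_eq_matrix_trace pb.basis, Matrix.trace]
  apply Finset.sum_eq_zero
  intro j _
  have hj : (j : ℕ) < n := hdim.le.trans_lt' j.2
  rw [Matrix.diag_apply, Algebra.leftMulMatrix_eq_repr_mul, pb.basis_eq_pow, hgen, ← pow_add]
  by_cases h : t + j < n
  · have : AdjoinRoot.root f ^ (t + (j : ℕ)) = pb.basis ⟨t + j, by omega⟩ := by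
      rw [pb.basis_eq_pow, hgen]
    rw [this, Module.Basis.repr_self, Finsupp.single_apply, if_neg]
    intro e
    have := congrArg Fin.val e
    simp at this
    omega
  · have : AdjoinRoot.root f ^ (t + (j : ℕ)) =
        s • pb.basis ⟨t + j - n, by omega⟩ := by
      rw [pb.basis_eq_pow, hgen, Algebra.smul_def, ← hroot, ← pow_add]
      congr 1
      simp only
      omega
    rw [this, map_smul, Module.Basis.repr_self, Finsupp.smul_apply, Finsupp.single_apply, if_neg,
      smul_zero]
    intro e
    have := congrArg Fin.val e
    simp at this
    omega

/-- The abstract form of the result, for an algebra of dimension `n` generated by an element with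
prescribed traces of powers. -/
lemma traceForm_equivalent_aux (k L : Type*) [Field k] [CommRing L] [Algebra k L]
    (hchar : (2 : k) ≠ 0) (n m : ℕ) (hm : n = m + m) (hpos : 0 < n) (hninv : (n : k) ≠ 0)
    (s : k) (hs : s ≠ 0) (x : L) (hroot : x ^ n = algebraMap k L s)
    (htr : ∀ t, 0 < t → t < n → Algebra.trace k L (x ^ t) = 0)
    (hfr : Module.finrank k L = n) [Module.Finite k L] :
    QuadraticMap.Equivalent (traceQuadraticForm k L)
      (QuadraticMap.weightedSumSquares k (evenCyclicTraceWeights k n s)) := by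
  have h0 : Algebra.trace k L (x ^ 0) = n := by
    rw [pow_zero, ← map_one (algebraMap k L), Algebra.trace_algebraMap, hfr]
    simp
  have h1 : Algebra.trace k L (x ^ n) = n * s := by
    rw [hroot, Algebra.trace_algebraMap, hfr, nsmul_eq_mul]
  have h2 : ∀ t, n < t → t < n + n → Algebra.trace k L (x ^ t) = 0 := by
    intro t ht ht'
    have : x ^ t = s • x ^ (t - n) := by
      rw [Algebra.smul_def, ← hroot, ← pow_add]
      congr 1
      omega
    rw [this, map_smul, htr _ (by omega) (by omega), smul_zero]
  have hB : ∀ i j, Algebra.traceForm k L (x ^ i) (x ^ j) = Algebra.trace k L (x ^ (i + j)) := by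
    intro i j
    rw [Algebra.traceForm_apply, pow_add]
  obtain ⟨c, hc⟩ : ∃ c : k, 2 * c * (n * s) = 1 :=
    ⟨(2 * (n * s))⁻¹, by field_simp⟩
  let v : Fin n → L := fun i =>
    if (i : ℕ) = 0 then x ^ 0
    else if (i : ℕ) = 1 then x ^ m
    else if (i : ℕ) % 2 = 0 then x ^ ((i : ℕ) / 2) + c • x ^ (n - (i : ℕ) / 2)
    else x ^ ((i : ℕ) / 2) - c • x ^ (n - (i : ℕ) / 2)
  have hz : ∀ i j, 0 < i + j → i + j < n + n → i + j ≠ n →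
      Algebra.traceForm k L (x ^ i) (x ^ j) = 0 := by
    intro i j a b d
    rw [hB]
    rcases lt_or_gt_of_ne d with e | e
    · exact htr _ a e
    · exact h2 _ e b
  have hnn : ∀ i j, i + j = n → Algebra.traceForm k L (x ^ i) (x ^ j) = n * s := by
    intro i j a
    rw [hB, a, h1]
  have hdiag : ∀ i, Algebra.traceForm k L (v i) (v i) = evenCyclicTraceWeights k n s i := by
    rintro ⟨i, hi⟩
    simp only [v, evenCyclicTraceWeights]
    split_ifs with ha hb hd
    · rw [hB, h0]
    · exact hnn _ _ hm.symm
    all_goals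
      simp only [map_add, map_sub, map_smul, LinearMap.add_apply, LinearMap.sub_apply,
        LinearMap.smul_apply, smul_eq_mul]
      rw [hz (i / 2) (i / 2) (by omega) (by omega) (by omega),
        hz (n - i / 2) (n - i / 2) (by omega) (by omega) (by omega),
        hnn (i / 2) (n - i / 2) (by omega), hnn (n - i / 2) (i / 2) (by omega)]
      first
        | linear_combination hc
        | linear_combination -hc
  have hlt : ∀ i j : Fin n, i < j → Algebra.traceForm k L (v i) (v j) = 0 := by
    rintro ⟨i, hi⟩ ⟨j, hj⟩ hij
    have hij' : i < j := hij
    clear hij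
    simp only [v]
    by_cases hj1 : j = 1
    · subst hj1
      rw [if_pos (by omega), if_neg (by omega), if_pos rfl]
      exact hz _ _ (by omega) (by omega) (by omega)
    rw [if_neg (show ¬ j = 0 by omega), if_neg hj1]
    by_cases hi0 : i = 0
    · rw [if_pos hi0]
      split_ifs <;>
      simp only [map_add, map_sub, map_smul, LinearMap.add_apply, LinearMap.sub_apply,
        LinearMap.smul_apply, smul_eq_mul] <;>
      rw [hz 0 (j / 2) (by omega) (by omega) (by omega),
        hz 0 (n - j / 2) (by omega) (by omega) (by omega)] <;> ring
    rw [if_neg hi0]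
    by_cases hi1 : i = 1
    · rw [if_pos hi1]
      split_ifs <;>
      simp only [map_add, map_sub, map_smul, LinearMap.add_apply, LinearMap.sub_apply,
        LinearMap.smul_apply, smul_eq_mul] <;>
      rw [hz m (j / 2) (by omega) (by omega) (by omega),
        hz m (n - j / 2) (by omega) (by omega) (by omega)] <;> ring
    rw [if_neg hi1]
    by_cases he : i / 2 = j / 2
    · rw [if_pos (show i % 2 = 0 by omega), if_neg (show ¬ j % 2 = 0 by omega), he]
      simp only [map_add, map_sub, map_smul, LinearMap.add_apply, LinearMap.sub_apply,
        LinearMap.smul_apply, smul_eq_mul]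
      rw [hz (j / 2) (j / 2) (by omega) (by omega) (by omega),
        hz (n - j / 2) (n - j / 2) (by omega) (by omega) (by omega),
        hnn (j / 2) (n - j / 2) (by omega), hnn (n - j / 2) (j / 2) (by omega)]
      ring
    · split_ifs <;>
      simp only [map_add, map_sub, map_smul, LinearMap.add_apply, LinearMap.sub_apply,
        LinearMap.smul_apply, smul_eq_mul] <;>
      rw [hz (i / 2) (j / 2) (by omega) (by omega) (by omega),
        hz (n - i / 2) (n - j / 2) (by omega) (by omega) (by omega),
        hz (i / 2) (n - j / 2) (by omega) (by omega) (by omega),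
        hz (n - i / 2) (j / 2) (by omega) (by omega) (by omega)] <;> ring
  have hsymm : ∀ a b : L, Algebra.traceForm k L a b = Algebra.traceForm k L b a := by
    intro a b
    rw [Algebra.traceForm_apply, Algebra.traceForm_apply, mul_comm]
  have hortho : (Algebra.traceForm k L).IsOrthoᵢ v := by
    intro i j hij
    rcases lt_or_gt_of_ne hij with h | h
    · exact hlt i j h
    · exact (hsymm _ _).trans (hlt j i h)
  have hli : LinearIndependent k v := by
    apply LinearMap.linearIndependent_of_isOrthoᵢ hortho
    intro i
    rw [hdiag, evenCyclicTraceWeights]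
    split_ifs
    · exact hninv
    · exact mul_ne_zero hninv hs
    · exact one_ne_zero
    · exact neg_ne_zero.mpr one_ne_zero
  have : Nonempty (Fin n) := ⟨⟨0, hpos⟩⟩
  let b := basisOfLinearIndependentOfCardEqFinrank hli (by rw [hfr, Fintype.card_fin])
  have hb : (b : Fin n → L) = v := coe_basisOfLinearIndependentOfCardEqFinrank hli _
  letI : Invertible (2 : k) := invertibleOfNonzero hchar
  have hass : QuadraticMap.associated (R := k) (traceQuadraticForm k L) =
      Algebra.traceForm k L := QuadraticMap.associated_left_inverse k hsymm
  have key := QuadraticMap.basisRepr_eq_of_iIsOrtho (traceQuadraticForm k L) b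
    (by rw [hass, hb]; exact hortho)
  have hw : (fun i => traceQuadraticForm k L (b i)) = evenCyclicTraceWeights k n s := by
    funext i
    rw [hb, ← hdiag]
    rfl
  rw [hw] at key
  exact key ▸ ⟨QuadraticMap.isometryEquivBasisRepr _ b⟩

/-- For `k` of characteristic `≠ 2`, `n` even positive and invertible in `k`, and `Xⁿ - s`
irreducible, the trace form of `L = k[X]/(Xⁿ - s)` is isometric to
`⟨n⟩ ⊥ ⟨n·s⟩ ⊥ ((n-2)/2 copies of (⟨1⟩ ⊥ ⟨-1⟩))`. -/
theorem traceForm_adjoinRoot_pow_sub_of_even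
    (k : Type*) [Field k] (hchar : (2 : k) ≠ 0)
    (n : ℕ) (hn : Even n) (hpos : 0 < n) (hninv : (n : k) ≠ 0)
    (s : k) (hirr : Irreducible ((X : k[X]) ^ n - C s)) :
    QuadraticMap.Equivalent
      (traceQuadraticForm k (AdjoinRoot ((X : k[X]) ^ n - C s)))
      (QuadraticMap.weightedSumSquares k (evenCyclicTraceWeights k n s)) := by
  obtain ⟨m, hm⟩ := hn
  have hs : s ≠ 0 := by
    rintro rfl
    rw [C_0, sub_zero] at hirr
    exact not_irreducible_pow (by omega) hirr
  have htr := trace_root_pow_eq_zero k n hpos s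
  have hmon : ((X : k[X]) ^ n - C s).Monic := monic_X_pow_sub_C s hpos.ne'
  have hdeg : ((X : k[X]) ^ n - C s).natDegree = n := natDegree_X_pow_sub_C
  have hroot : AdjoinRoot.root ((X : k[X]) ^ n - C s) ^ n = algebraMap k _ s := by
    have h := AdjoinRoot.eval₂_root ((X : k[X]) ^ n - C s)
    simp only [eval₂_sub, eval₂_X_pow, eval₂_C] at h
    exact sub_eq_zero.mp h
  let pb := AdjoinRoot.powerBasis' hmon
  have hfr : Module.finrank k (AdjoinRoot ((X : k[X]) ^ n - C s)) = n := by
    rw [pb.finrank, AdjoinRoot.powerBasis'_dim, hdeg]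
  have : Module.Finite k (AdjoinRoot ((X : k[X]) ^ n - C s)) := pb.finite
  exact traceForm_equivalent_aux k _ hchar n m hm hpos hninv s hs _ hroot htr hfr
end

section
/- Let A and B be Noetherian local rings and let φ : A → B be a local ring homomorphism making B a formally unramified A-algebra that is essentially of finite type over A. Then the maximal ideal of B equals the extension m_A·B of the maximal ideal m_A of A along φ; in particular, if t₁, …, t_r generate m_A, then φ(t₁), …, φ(t_r) generate the maximal ideal of B. -/
/-- For a local homomorphism of Noetherian local rings making `B` a formally unramified,
essentially of finite type `A`-algebra, the maximal ideal of `B` is the extension of the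
maximal ideal of `A`; in particular generators of `m_A` map to generators of `m_B`. -/
theorem maximalIdeal_eq_map_of_formallyUnramified
    (A B : Type*) [CommRing A] [CommRing B] [IsLocalRing A] [IsLocalRing B]
    [IsNoetherianRing A] [IsNoetherianRing B] [Algebra A B]
    [IsLocalHom (algebraMap A B)]
    [Algebra.FormallyUnramified A B] [Algebra.EssFiniteType A B] :
    IsLocalRing.maximalIdeal B =
      (IsLocalRing.maximalIdeal A).map (algebraMap A B) ∧
    ∀ (r : ℕ) (t : Fin r → A),
      Ideal.span (Set.range t) = IsLocalRing.maximalIdeal A →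
      Ideal.span (Set.range fun i => algebraMap A B (t i)) =
        IsLocalRing.maximalIdeal B := by
  have h : IsLocalRing.maximalIdeal B =
      (IsLocalRing.maximalIdeal A).map (algebraMap A B) :=
    (Algebra.FormallyUnramified.map_maximalIdeal (R := A) (S := B)).symm
  refine ⟨h, fun r t ht => ?_⟩
  rw [h, ← ht, Ideal.map_span, ← Set.range_comp]
  rfl
end

section
/- Let A be a commutative local ring with maximal ideal m, let t₀ ∈ m, and let n ≥ 1 be an integer. Then B = A[z]/(zⁿ − t₀) is a local ring whose maximal ideal is generated by the image of m together with the class z̄ of z, i.e. it equals m·B + (z̄). -/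
open Polynomial

/-- For a commutative local ring `A` with maximal ideal `m`, `t₀ ∈ m` and `n ≥ 1`,
the ring `B = A[z]/(zⁿ - t₀)` is local, with maximal ideal `m·B + (z̄)`. -/
theorem adjoinRoot_pow_sub_isLocalRing
    (A : Type*) [CommRing A] [IsLocalRing A]
    (t₀ : A) (ht : t₀ ∈ IsLocalRing.maximalIdeal A) (n : ℕ) (hn : 1 ≤ n) :
    ∃ h : IsLocalRing (AdjoinRoot ((X : A[X]) ^ n - C t₀)),
      IsLocalRing.maximalIdeal (AdjoinRoot ((X : A[X]) ^ n - C t₀)) =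
        (IsLocalRing.maximalIdeal A).map
            (algebraMap A (AdjoinRoot ((X : A[X]) ^ n - C t₀))) ⊔
          Ideal.span {AdjoinRoot.root ((X : A[X]) ^ n - C t₀)} := by
  set f : A[X] := (X : A[X]) ^ n - C t₀ with hf
  have hn0 : n ≠ 0 := by omega
  have hmonic : f.Monic := monic_X_pow_sub_C t₀ hn0
  have hint : Algebra.IsIntegral A (AdjoinRoot f) := by
    have : Module.Finite A (AdjoinRoot f) := hmonic.finite_adjoinRoot
    infer_instance
  have hroot : AdjoinRoot.root f ^ n = algebraMap A (AdjoinRoot f) t₀ := by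
    have h := AdjoinRoot.eval₂_root f
    rw [hf] at h
    simp only [eval₂_sub, eval₂_pow, eval₂_X, eval₂_C] at h
    exact sub_eq_zero.mp h
  set J : Ideal (AdjoinRoot f) := (IsLocalRing.maximalIdeal A).map
    (algebraMap A (AdjoinRoot f)) ⊔ Ideal.span {AdjoinRoot.root f} with hJ
  -- every maximal ideal contains `J`
  have hle : ∀ M : Ideal (AdjoinRoot f), M.IsMaximal → J ≤ M := by
    intro M hM
    have hc : (M.comap (algebraMap A (AdjoinRoot f))).IsMaximal :=
      Ideal.isMaximal_comap_of_isIntegral_of_isMaximal M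
    have hc' := IsLocalRing.eq_maximalIdeal hc
    refine sup_le (Ideal.map_le_iff_le_comap.mpr hc'.ge) ?_
    rw [Ideal.span_singleton_le_iff_mem]
    refine hM.isPrime.mem_of_pow_mem n ?_
    rw [hroot]
    have : t₀ ∈ M.comap (algebraMap A (AdjoinRoot f)) := hc' ▸ ht
    exact this
  -- the residue map `z ↦ 0`
  have hev : f.eval₂ (IsLocalRing.residue A) 0 = 0 := by
    have : IsLocalRing.residue A t₀ = 0 := (IsLocalRing.residue_eq_zero_iff t₀).mpr ht
    simp [hf, hn0, this]
  let φ : AdjoinRoot f →+* IsLocalRing.ResidueField A :=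
    AdjoinRoot.lift (IsLocalRing.residue A) 0 hev
  have hφ : Function.Surjective φ := by
    intro y
    obtain ⟨a, rfl⟩ := IsLocalRing.residue_surjective y
    exact ⟨AdjoinRoot.of f a, AdjoinRoot.lift_of hev⟩
  have hker : (RingHom.ker φ).IsMaximal := RingHom.ker_isMaximal_of_surjective φ hφ
  have hkJ : RingHom.ker φ ≤ J := by
    intro b hb
    obtain ⟨p, rfl⟩ := AdjoinRoot.mk_surjective b
    have h0 : p.coeff 0 ∈ IsLocalRing.maximalIdeal A := by
      rw [← IsLocalRing.residue_eq_zero_iff]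
      have h1 : φ (AdjoinRoot.mk f p) = 0 := hb
      have h2 : φ (AdjoinRoot.mk f p) = p.eval₂ (IsLocalRing.residue A) 0 :=
        AdjoinRoot.lift_mk hev p
      rw [h2, eval₂_at_zero] at h1
      exact h1
    rw [← divX_mul_X_add p, map_add, map_mul, AdjoinRoot.mk_X, AdjoinRoot.mk_C]
    refine J.add_mem (J.mul_mem_left _ ?_) ?_
    · exact (le_sup_right : _ ≤ J) (Ideal.mem_span_singleton_self _)
    · exact (le_sup_left : _ ≤ J) (Ideal.mem_map_of_mem _ h0)
  have huniq : ∀ M : Ideal (AdjoinRoot f), M.IsMaximal → M = RingHom.ker φ := fun M hM =>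
    (hker.eq_of_le hM.ne_top (hkJ.trans (hle M hM))).symm
  have hloc : IsLocalRing (AdjoinRoot f) :=
    IsLocalRing.of_unique_max_ideal ⟨RingHom.ker φ, hker, huniq⟩
  refine ⟨hloc, ?_⟩
  have hJk : J = RingHom.ker φ := le_antisymm (hle _ hker) hkJ
  rw [hJk]
  exact huniq _ (IsLocalRing.maximalIdeal.isMaximal _)
end
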